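/- arXiv:1005.2897 — 2 statements merged into one kernel-verified Lean document; each statement's English description precedes it below -/
import Mathlib

section
/- The rewrite relation →ℓ of the call-by-value algebraic λ-calculus with algebraic reduction is AC-strongly-normalising: for every term M there exists n ∈ ℕ such that every →ℓ-rewrite sequence starting from M contains at most n steps performed by a rule other than associativity or commutativity of +. -/
namespace AlgLam

/-- Terms of the algebraic λ-calculus over a ring of scalars `R`,
    in de Bruijn representation. -/
inductive Term (R : Type u) : Type u
  | var : ℕ → Term R
  | lam : Term R → Term R
  | app : Term R → Term R → Term R
  | zero : Term R
  | smul : R → Term R → Term R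
  | add : Term R → Term R → Term R

namespace Term

variable {R : Type u}

/-- De Bruijn lifting: shift the free indices `≥ d` up by one. -/
def lift (d : ℕ) : Term R → Term R
  | var n => if n < d then var n else var (n + 1)
  | lam M => lam (lift (d + 1) M)
  | app M N => app (lift d M) (lift d N)
  | zero => zero
  | smul a M => smul a (lift d M)
  | add M N => add (lift d M) (lift d N)

/-- Capture-avoiding substitution of `N` for the free de Bruijn index `d`. -/
def subst (d : ℕ) (N : Term R) : Term R → Term R
  | var n => if n < d then var n else if n = d then N else var (n - 1)
  | lam M => lam (subst (d + 1) (lift 0 N) M)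
  | app M L => app (subst d N M) (subst d N L)
  | zero => zero
  | smul a M => smul a (subst d N M)
  | add M L => add (subst d N M) (subst d N L)

/-- Base terms: variables and λ-abstractions. -/
inductive IsBase : Term R → Prop
  | var (n : ℕ) : IsBase (var n)
  | lam (M : Term R) : IsBase (lam M)

/-- Values: `0`, base terms, scalar multiples of values, sums of values. -/
inductive IsValue : Term R → Prop
  | zero : IsValue zero
  | base {B : Term R} : IsBase B → IsValue B
  | smul (a : R) {V : Term R} : IsValue V → IsValue (smul a V)
  | add {V W : Term R} : IsValue V → IsValue W → IsValue (add V W)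

/-- `ClosedUnder d M` : every free index of `M` is `< d`. -/
def ClosedUnder : ℕ → Term R → Prop
  | d, var n => n < d
  | d, lam M => ClosedUnder (d + 1) M
  | d, app M N => ClosedUnder d M ∧ ClosedUnder d N
  | _, zero => True
  | d, smul _ M => ClosedUnder d M
  | d, add M N => ClosedUnder d M ∧ ClosedUnder d N

/-- A closed term (a program). -/
def Closed (M : Term R) : Prop := ClosedUnder 0 M

section Rules

variable [CommRing R]

/-- The rewrite relation `→a` of the call-by-name algebraic λ-calculus:
    ring rules and call-by-name application rules, closed under the ξ contexts. -/
inductive StepA : Term R → Term R → Prop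
  -- ring rules
  | assocL (M N L : Term R) : StepA (add M (add N L)) (add (add M N) L)
  | assocR (M N L : Term R) : StepA (add (add M N) L) (add M (add N L))
  | comm (M N : Term R) : StepA (add M N) (add N M)
  | factor (a b : R) (M : Term R) : StepA (add (smul a M) (smul b M)) (smul (a + b) M)
  | factor1 (a : R) (M : Term R) : StepA (add (smul a M) M) (smul (a + 1) M)
  | factor11 (M : Term R) : StepA (add M M) (smul (1 + 1) M)
  | mulMul (a b : R) (M : Term R) : StepA (smul a (smul b M)) (smul (a * b) M)
  | mulDist (a : R) (M N : Term R) : StepA (smul a (add M N)) (add (smul a M) (smul a N))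
  | oneSmul (M : Term R) : StepA (smul 1 M) M
  | zeroSmul (M : Term R) : StepA (smul 0 M) zero
  | smulZero (a : R) : StepA (smul a zero) zero
  | zeroAdd (M : Term R) : StepA (add zero M) M
  -- call-by-name application rules (A)
  | appAdd (M N L : Term R) : StepA (app (add M N) L) (add (app M L) (app N L))
  | appSmul (a : R) (M N : Term R) : StepA (app (smul a M) N) (smul a (app M N))
  | appZero (M : Term R) : StepA (app zero M) zero
  -- ξ context rules
  | ctxAppL {M M' : Term R} (N : Term R) : StepA M M' → StepA (app M N) (app M' N)
  | ctxAddL {M M' : Term R} (N : Term R) : StepA M M' → StepA (add M N) (add M' N)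
  | ctxAddR {N N' : Term R} (M : Term R) : StepA N N' → StepA (add M N) (add M N')
  | ctxSmul (a : R) {M M' : Term R} : StepA M M' → StepA (smul a M) (smul a M')

/-- The call-by-name β-reduction `→βn`, closed under the ξ contexts. -/
inductive StepBn : Term R → Term R → Prop
  | beta (M N : Term R) : StepBn (app (lam M) N) (subst 0 N M)
  | ctxAppL {M M' : Term R} (N : Term R) : StepBn M M' → StepBn (app M N) (app M' N)
  | ctxAddL {M M' : Term R} (N : Term R) : StepBn M M' → StepBn (add M N) (add M' N)
  | ctxAddR {N N' : Term R} (M : Term R) : StepBn N N' → StepBn (add M N) (add M N')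
  | ctxSmul (a : R) {M M' : Term R} : StepBn M M' → StepBn (smul a M) (smul a M')

/-- The rewrite relation `→a∪β`. -/
def StepAB (M N : Term R) : Prop := StepA M N ∨ StepBn M N

/-- The rewrite relation `→ℓ` of the call-by-value algebraic λ-calculus:
    ring rules, left- and right-linearity rules, closed under ξ and ξ_lin. -/
inductive StepL : Term R → Term R → Prop
  -- ring rules
  | assocL (M N L : Term R) : StepL (add M (add N L)) (add (add M N) L)
  | assocR (M N L : Term R) : StepL (add (add M N) L) (add M (add N L))
  | comm (M N : Term R) : StepL (add M N) (add N M)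
  | factor (a b : R) (M : Term R) : StepL (add (smul a M) (smul b M)) (smul (a + b) M)
  | factor1 (a : R) (M : Term R) : StepL (add (smul a M) M) (smul (a + 1) M)
  | factor11 (M : Term R) : StepL (add M M) (smul (1 + 1) M)
  | mulMul (a b : R) (M : Term R) : StepL (smul a (smul b M)) (smul (a * b) M)
  | mulDist (a : R) (M N : Term R) : StepL (smul a (add M N)) (add (smul a M) (smul a N))
  | oneSmul (M : Term R) : StepL (smul 1 M) M
  | zeroSmul (M : Term R) : StepL (smul 0 M) zero
  | smulZero (a : R) : StepL (smul a zero) zero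
  | zeroAdd (M : Term R) : StepL (add zero M) M
  -- left linearity (A_l), the argument must be a value
  | appAddV {V : Term R} (M N : Term R) : IsValue V →
      StepL (app (add M N) V) (add (app M V) (app N V))
  | appSmulV {V : Term R} (a : R) (M : Term R) : IsValue V →
      StepL (app (smul a M) V) (smul a (app M V))
  | appZeroV {V : Term R} : IsValue V → StepL (app zero V) zero
  -- right linearity (A_r), the function must be a base term
  | appAddB {B : Term R} (M N : Term R) : IsBase B →
      StepL (app B (add M N)) (add (app B M) (app B N))
  | appSmulB {B : Term R} (a : R) (M : Term R) : IsBase B →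
      StepL (app B (smul a M)) (smul a (app B M))
  | appZeroB {B : Term R} : IsBase B → StepL (app B zero) zero
  -- ξ context rules
  | ctxAppL {M M' : Term R} (N : Term R) : StepL M M' → StepL (app M N) (app M' N)
  | ctxAddL {M M' : Term R} (N : Term R) : StepL M M' → StepL (add M N) (add M' N)
  | ctxAddR {N N' : Term R} (M : Term R) : StepL N N' → StepL (add M N) (add M N')
  | ctxSmul (a : R) {M M' : Term R} : StepL M M' → StepL (smul a M) (smul a M')
  -- ξ_lin context rule
  | ctxAppR {V M M' : Term R} : IsValue V → StepL M M' → StepL (app V M) (app V M')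

/-- The call-by-value β-reduction `→βv`, closed under ξ and ξ_lin. -/
inductive StepBv : Term R → Term R → Prop
  | beta (M : Term R) {B : Term R} : IsBase B → StepBv (app (lam M) B) (subst 0 B M)
  | ctxAppL {M M' : Term R} (N : Term R) : StepBv M M' → StepBv (app M N) (app M' N)
  | ctxAddL {M M' : Term R} (N : Term R) : StepBv M M' → StepBv (add M N) (add M' N)
  | ctxAddR {N N' : Term R} (M : Term R) : StepBv N N' → StepBv (add M N) (add M N')
  | ctxSmul (a : R) {M M' : Term R} : StepBv M M' → StepBv (smul a M) (smul a M')
  | ctxAppR {V M M' : Term R} : IsValue V → StepBv M M' → StepBv (app V M) (app V M')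

/-- The rewrite relation `→ℓ∪β`. -/
def StepLB (M N : Term R) : Prop := StepL M N ∨ StepBv M N

end Rules

/-- Steps of `→a` performed by an associativity or commutativity rule
    (closed under the ξ contexts). -/
inductive StepACa : Term R → Term R → Prop
  | assocL (M N L : Term R) : StepACa (add M (add N L)) (add (add M N) L)
  | assocR (M N L : Term R) : StepACa (add (add M N) L) (add M (add N L))
  | comm (M N : Term R) : StepACa (add M N) (add N M)
  | ctxAppL {M M' : Term R} (N : Term R) : StepACa M M' → StepACa (app M N) (app M' N)
  | ctxAddL {M M' : Term R} (N : Term R) : StepACa M M' → StepACa (add M N) (add M' N)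
  | ctxAddR {N N' : Term R} (M : Term R) : StepACa N N' → StepACa (add M N) (add M N')
  | ctxSmul (a : R) {M M' : Term R} : StepACa M M' → StepACa (smul a M) (smul a M')

/-- Steps of `→ℓ` performed by an associativity or commutativity rule
    (closed under the ξ and ξ_lin contexts). -/
inductive StepACl : Term R → Term R → Prop
  | assocL (M N L : Term R) : StepACl (add M (add N L)) (add (add M N) L)
  | assocR (M N L : Term R) : StepACl (add (add M N) L) (add M (add N L))
  | comm (M N : Term R) : StepACl (add M N) (add N M)
  | ctxAppL {M M' : Term R} (N : Term R) : StepACl M M' → StepACl (app M N) (app M' N)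
  | ctxAddL {M M' : Term R} (N : Term R) : StepACl M M' → StepACl (add M N) (add M' N)
  | ctxAddR {N N' : Term R} (M : Term R) : StepACl N N' → StepACl (add M N) (add M N')
  | ctxSmul (a : R) {M M' : Term R} : StepACl M M' → StepACl (smul a M) (smul a M')
  | ctxAppR {V M M' : Term R} : IsValue V → StepACl M M' → StepACl (app V M) (app V M')

section NonAC

variable [CommRing R]

/-- Steps of `→a` performed by a rule other than associativity or commutativity of `+`
    (closed under the ξ contexts). -/
inductive StepNAa : Term R → Term R → Prop
  | factor (a b : R) (M : Term R) : StepNAa (add (smul a M) (smul b M)) (smul (a + b) M)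
  | factor1 (a : R) (M : Term R) : StepNAa (add (smul a M) M) (smul (a + 1) M)
  | factor11 (M : Term R) : StepNAa (add M M) (smul (1 + 1) M)
  | mulMul (a b : R) (M : Term R) : StepNAa (smul a (smul b M)) (smul (a * b) M)
  | mulDist (a : R) (M N : Term R) : StepNAa (smul a (add M N)) (add (smul a M) (smul a N))
  | oneSmul (M : Term R) : StepNAa (smul 1 M) M
  | zeroSmul (M : Term R) : StepNAa (smul 0 M) zero
  | smulZero (a : R) : StepNAa (smul a zero) zero
  | zeroAdd (M : Term R) : StepNAa (add zero M) M
  | appAdd (M N L : Term R) : StepNAa (app (add M N) L) (add (app M L) (app N L))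
  | appSmul (a : R) (M N : Term R) : StepNAa (app (smul a M) N) (smul a (app M N))
  | appZero (M : Term R) : StepNAa (app zero M) zero
  | ctxAppL {M M' : Term R} (N : Term R) : StepNAa M M' → StepNAa (app M N) (app M' N)
  | ctxAddL {M M' : Term R} (N : Term R) : StepNAa M M' → StepNAa (add M N) (add M' N)
  | ctxAddR {N N' : Term R} (M : Term R) : StepNAa N N' → StepNAa (add M N) (add M N')
  | ctxSmul (a : R) {M M' : Term R} : StepNAa M M' → StepNAa (smul a M) (smul a M')

/-- Steps of `→ℓ` performed by a rule other than associativity or commutativity of `+`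
    (closed under the ξ and ξ_lin contexts). -/
inductive StepNAl : Term R → Term R → Prop
  | factor (a b : R) (M : Term R) : StepNAl (add (smul a M) (smul b M)) (smul (a + b) M)
  | factor1 (a : R) (M : Term R) : StepNAl (add (smul a M) M) (smul (a + 1) M)
  | factor11 (M : Term R) : StepNAl (add M M) (smul (1 + 1) M)
  | mulMul (a b : R) (M : Term R) : StepNAl (smul a (smul b M)) (smul (a * b) M)
  | mulDist (a : R) (M N : Term R) : StepNAl (smul a (add M N)) (add (smul a M) (smul a N))
  | oneSmul (M : Term R) : StepNAl (smul 1 M) M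
  | zeroSmul (M : Term R) : StepNAl (smul 0 M) zero
  | smulZero (a : R) : StepNAl (smul a zero) zero
  | zeroAdd (M : Term R) : StepNAl (add zero M) M
  | appAddV {V : Term R} (M N : Term R) : IsValue V →
      StepNAl (app (add M N) V) (add (app M V) (app N V))
  | appSmulV {V : Term R} (a : R) (M : Term R) : IsValue V →
      StepNAl (app (smul a M) V) (smul a (app M V))
  | appZeroV {V : Term R} : IsValue V → StepNAl (app zero V) zero
  | appAddB {B : Term R} (M N : Term R) : IsBase B →
      StepNAl (app B (add M N)) (add (app B M) (app B N))
  | appSmulB {B : Term R} (a : R) (M : Term R) : IsBase B →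
      StepNAl (app B (smul a M)) (smul a (app B M))
  | appZeroB {B : Term R} : IsBase B → StepNAl (app B zero) zero
  | ctxAppL {M M' : Term R} (N : Term R) : StepNAl M M' → StepNAl (app M N) (app M' N)
  | ctxAddL {M M' : Term R} (N : Term R) : StepNAl M M' → StepNAl (add M N) (add M' N)
  | ctxAddR {N N' : Term R} (M : Term R) : StepNAl N N' → StepNAl (add M N) (add M N')
  | ctxSmul (a : R) {M M' : Term R} : StepNAl M M' → StepNAl (smul a M) (smul a M')
  | ctxAppR {V M M' : Term R} : IsValue V → StepNAl M M' → StepNAl (app V M) (app V M')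

end NonAC

/-- The call-by-value-to-call-by-name encoding `M ↦ M~`.
    The fresh variables `f`, `g`, `h` are handled by de Bruijn lifting. -/
def cbvEnc : Term R → Term R
  | var n => lam (app (var 0) (var (n + 1)))
  | zero => zero
  | lam M => lam (app (var 0) (lift 0 (lam (cbvEnc M))))
  | app M N =>
      lam (app (lift 0 (cbvEnc M))
        (lam (app (lift 0 (lift 0 (cbvEnc N)))
          (lam (app (app (var 1) (var 0)) (var 2))))))
  | smul a M => lam (app (smul a (lift 0 (cbvEnc M))) (var 0))
  | add M N => lam (app (add (lift 0 (cbvEnc M)) (lift 0 (cbvEnc N))) (var 0))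

/-- The value encoding `Ψ` (its value on non-values is irrelevant). -/
def psi : Term R → Term R
  | var n => var n
  | zero => zero
  | lam M => lam (cbvEnc M)
  | smul a V => smul a (psi V)
  | add V W => add (psi V) (psi W)
  | app M N => app (psi M) (psi N)

/-- The call-by-name-to-call-by-value encoding `M ↦ ⟦M⟧`. -/
def cbnEnc : Term R → Term R
  | var n => var n
  | zero => lam (app zero (var 0))
  | lam M => lam (app (var 0) (lift 0 (lam (cbnEnc M))))
  | app M N =>
      lam (app (lift 0 (cbnEnc M))
        (lam (app (app (var 0) (lift 0 (lift 0 (cbnEnc N)))) (var 1))))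
  | smul a M => lam (app (smul a (lift 0 (cbnEnc M))) (var 0))
  | add M N => lam (app (add (lift 0 (cbnEnc M)) (lift 0 (cbnEnc N))) (var 0))

/-- The value encoding `Φ` (its value on non-values is irrelevant). -/
def phi : Term R → Term R
  | var n => app (var n) (lam (var 0))
  | zero => zero
  | lam M => lam (cbnEnc M)
  | smul a V => smul a (phi V)
  | add V W => add (phi V) (phi W)
  | app M N => app (phi M) (phi N)

/-- A measure on terms used to define the administrative operation `(:)`. -/
def size : Term R → ℕ
  | var _ => 1
  | lam _ => 1
  | zero => 1
  | smul _ M => 1 + size M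
  | add M N => 1 + size M + size N
  | app M N => size M * (size N + 1)

theorem size_pos : ∀ M : Term R, 0 < size M
  | var _ => Nat.one_pos
  | lam _ => Nat.one_pos
  | zero => Nat.one_pos
  | smul _ M => by simp [size]
  | add M N => by simp [size]
  | app M N => Nat.mul_pos (size_pos M) (Nat.succ_pos _)

/-- The administrative infix operation `(:)` of the call-by-value to call-by-name
    simulation: `colon M K` is `M : K`. -/
def colon : Term R → Term R → Term R
  | zero, _ => zero
  | var n, K => app K (var n)
  | lam M, K => app K (lam (cbvEnc M))
  | smul a M, K => smul a (colon M K)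
  | add M N, K => add (colon M K) (colon N K)
  | app zero _, _ => zero
  | app (var n) N, K =>
      colon N (lam (app (app (var (n + 1)) (var 0)) (lift 0 K)))
  | app (lam M) N, K =>
      colon N (lam (app (app (lift 0 (lam (cbvEnc M))) (var 0)) (lift 0 K)))
  | app (smul a M) N, K => smul a (colon (app M N) K)
  | app (add M M') N, K => add (colon (app M N) K) (colon (app M' N) K)
  | app (app M M') L, K =>
      colon (app M M')
        (lam (app (lift 0 (cbvEnc L))
          (lam (app (app (var 1) (var 0)) (lift 0 (lift 0 K))))))
termination_by M _ => size M
decreasing_by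
  all_goals simp only [size]
  · omega
  · omega
  · omega
  · nlinarith [size_pos N]
  · nlinarith [size_pos N]
  · nlinarith [size_pos M, size_pos N]
  · nlinarith [size_pos M, size_pos M', size_pos N]
  · nlinarith [size_pos M, size_pos M', size_pos N]
  · nlinarith [size_pos L, Nat.mul_pos (size_pos M) (Nat.succ_pos (size M'))]



section Equalities

variable [CommRing R]

/-- The restricted algebraic equality `=ℓ^F` on a fragment `F`. -/
def EqL (F : Set (Term R)) (M N : Term R) : Prop :=
  M ∈ F ∧ N ∈ F ∧ (StepL M N ∨ StepL N M)

/-- The relation `=ℓ∪β^F` : restricted algebraic equality together with `→βv` restricted to `F`. -/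
def EqLB (F : Set (Term R)) (M N : Term R) : Prop :=
  EqL F M N ∨ (M ∈ F ∧ N ∈ F ∧ StepBv M N)

/-- The restricted algebraic equality `=a^F` on a fragment `F`. -/
def EqA (F : Set (Term R)) (M N : Term R) : Prop :=
  M ∈ F ∧ N ∈ F ∧ (StepA M N ∨ StepA N M)

/-- The relation `=a∪β^F` : restricted algebraic equality together with `→βn` restricted to `F`. -/
def EqAB (F : Set (Term R)) (M N : Term R) : Prop :=
  EqA F M N ∨ (M ∈ F ∧ N ∈ F ∧ StepBn M N)

/-- The unrestricted algebraic equality `=ℓ` (symmetric closure of `→ℓ`). -/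
def EqLfull (M N : Term R) : Prop := StepL M N ∨ StepL N M

/-- The unrestricted relation `=ℓ∪β`. -/
def EqLBfull (M N : Term R) : Prop := EqLfull M N ∨ StepBv M N

/-- The unrestricted algebraic equality `=a` (symmetric closure of `→a`). -/
def EqAfull (M N : Term R) : Prop := StepA M N ∨ StepA N M

/-- The unrestricted relation `=a∪β`. -/
def EqABfull (M N : Term R) : Prop := EqAfull M N ∨ StepBn M N

end Equalities

/-- A polynomial interpretation of terms, invariant under the AC rules and strictly decreasing
along every other rule of `→ℓ`. -/
def weight : Term R → ℕ
  | var _ => 1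
  | lam _ => 1
  | zero => 0
  | smul _ M => 1 + 2 * weight M
  | add M N => 2 + weight M + weight N
  | app M N => (3 * weight M + 2) * (3 * weight N + 2)

theorem StepACl.weight_eq {M N : Term R} (h : StepACl M N) : weight N = weight M := by
  induction h <;> simp only [weight, *] <;> ring

section Statements

variable [CommRing R]

theorem StepNAl.weight_lt {M N : Term R} (h : StepNAl M N) : weight N < weight M := by
  induction h
  case ctxAppL ih | ctxAppR ih =>
    simp only [weight]
    gcongr
  all_goals
    simp only [weight]
    first | omega | nlinarith

/-- `→ℓ` is AC-strongly-normalising: for every term `M` there is `n : ℕ`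
bounding, for every `→ℓ`-rewrite sequence starting from `M` (each step labelled by
whether it is performed by an associativity/commutativity rule or by another rule),
the number of steps performed by a rule other than associativity or commutativity. -/
theorem ac_strongly_normalising_l (M : Term R) :
    ∃ n : ℕ, ∀ (k : ℕ) (f : ℕ → Term R) (ac : ℕ → Bool),
      f 0 = M →
      (∀ i < k,
        (ac i = true ∧ StepACl (f i) (f (i + 1))) ∨
        (ac i = false ∧ StepNAl (f i) (f (i + 1)))) →
      ((Finset.range k).filter (fun i => ac i = false)).card ≤ n := by
  refine ⟨weight M, fun k f ac h0 hstep => ?_⟩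
  suffices h : ((Finset.range k).filter (fun i => ac i = false)).card + weight (f k)
      ≤ weight M by omega
  induction k with
  | zero => simp [h0]
  | succ k ih =>
    have ih := ih fun i hi => hstep i (by omega)
    rw [Finset.range_add_one, Finset.filter_insert]
    rcases hstep k (by omega) with ⟨hac, hs⟩ | ⟨hac, hs⟩
    · have := hs.weight_eq
      simp only [hac, Bool.true_eq_false, if_false]
      omega
    · have := hs.weight_lt
      rw [if_pos hac, Finset.card_insert_of_notMem (by simp)]
      omega

end Statements

end Term

end AlgLam
end

section
/- If M →ℓ∪β N, then for every base term K, M:K →a∪β* N:K, where →a∪β* denotes the reflexive-transitive closure of →a∪β. -/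
namespace AlgLam

namespace Term

variable {R : Type u}

theorem lift_lift (M : Term R) (i d : ℕ) (h : i ≤ d) :
    lift (d + 1) (lift i M) = lift i (lift d M) := by
  induction M generalizing i d with
  | var n =>
    simp only [lift]
    split_ifs <;> simp only [lift] <;> split_ifs <;> first | rfl | omega
  | lam M ih => simp [lift, ih (i + 1) (d + 1) (by omega)]
  | app M N ihM ihN => simp [lift, ihM i d h, ihN i d h]
  | zero => rfl
  | smul a M ih => simp [lift, ih i d h]
  | add M N ihM ihN => simp [lift, ihM i d h, ihN i d h]

theorem subst_lift_self (M N : Term R) (d : ℕ) : subst d N (lift d M) = M := by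
  induction M generalizing d N with
  | var n =>
    simp only [lift]
    split_ifs <;> simp only [subst] <;> split_ifs <;> first | rfl | omega
  | lam M ih => simp [lift, subst, ih]
  | app M N ihM ihN => simp [lift, subst, ihM, ihN]
  | zero => rfl
  | smul a M ih => simp [lift, subst, ih]
  | add M N ihM ihN => simp [lift, subst, ihM, ihN]

theorem subst_succ_lift (M N : Term R) (i d : ℕ) (h : i ≤ d) :
    subst (d + 1) (lift i N) (lift i M) = lift i (subst d N M) := by
  induction M generalizing i d N with
  | var n =>
    rcases lt_trichotomy n d with hn | rfl | hn
    · have hd : n < d + 1 := by omega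
      by_cases hi : n < i <;> simp [lift, subst, hn, hi, hd]
    · simp [lift, subst, Nat.not_lt.2 h]
    · have hi : ¬ n < i := by omega
      have hi' : ¬ n - 1 < i := by omega
      have hd : ¬ n < d := by omega
      have hne : n ≠ d := by omega
      simp only [lift, subst, hi, hi', hd, hne, if_false, Nat.add_lt_add_iff_right,
        Nat.add_right_cancel_iff]
      congr 1
      omega
  | lam M ih =>
    simp [lift, subst, ← lift_lift N 0 i (Nat.zero_le i), ← ih _ (i + 1) (d + 1) (by omega)]
  | app M L ihM ihL => simp [lift, subst, ihM N i d h, ihL N i d h]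
  | zero => rfl
  | smul a M ih => simp [lift, subst, ih N i d h]
  | add M L ihM ihL => simp [lift, subst, ihM N i d h, ihL N i d h]

theorem cbvEnc_lift (M : Term R) (d : ℕ) : cbvEnc (lift d M) = lift d (cbvEnc M) := by
  induction M generalizing d with
  | var n => by_cases hn : n < d <;> simp [lift, cbvEnc, hn]
  | lam M ih => simp [lift, cbvEnc, ih, lift_lift]
  | app M N ihM ihN => simp [lift, cbvEnc, ihM, ihN, lift_lift]
  | zero => rfl
  | smul a M ih => simp [lift, cbvEnc, ih, lift_lift]
  | add M N ihM ihN => simp [lift, cbvEnc, ihM, ihN, lift_lift]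

theorem psi_lift (M : Term R) (d : ℕ) : psi (lift d M) = lift d (psi M) := by
  induction M generalizing d with
  | var n => by_cases hn : n < d <;> simp [lift, psi, hn]
  | lam M ih => simp [lift, psi, cbvEnc_lift]
  | app M N ihM ihN => simp [lift, psi, ihM, ihN]
  | zero => rfl
  | smul a M ih => simp [lift, psi, ih]
  | add M N ihM ihN => simp [lift, psi, ihM, ihN]

theorem IsBase.lift {B : Term R} (hB : IsBase B) (d : ℕ) : IsBase (lift d B) := by
  cases hB with
  | var n =>
    simp only [Term.lift]
    split_ifs <;> exact .var _
  | lam M => exact .lam _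

theorem cbvEnc_of_isBase {B : Term R} (hB : IsBase B) :
    cbvEnc B = lam (app (var 0) (lift 0 (psi B))) := by
  cases hB <;> simp [cbvEnc, psi, lift]

theorem cbvEnc_subst (M : Term R) {B : Term R} (hB : IsBase B) (d : ℕ) :
    cbvEnc (subst d B M) = subst d (psi B) (cbvEnc M) := by
  induction M generalizing d B with
  | var n =>
    rcases lt_trichotomy n d with hn | rfl | hn
    · simp [subst, cbvEnc, hn]
    · simp [subst, cbvEnc, cbvEnc_of_isBase hB]
    · have hd : ¬ n < d := by omega
      have hne : n ≠ d := by omega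
      have hs : n - 1 + 1 = n := by omega
      simp [subst, cbvEnc, hd, hne, hs]
  | lam M ih =>
    simp [lift, subst, cbvEnc, ih (hB.lift 0), psi_lift, ← lift_lift (psi B) 0 0 le_rfl,
      subst_succ_lift _ _ 1 (d + 1) (by omega)]
  | app M N ihM ihN =>
    simp [subst, cbvEnc, ihM hB, ihN hB, subst_succ_lift]
  | zero => rfl
  | smul a M ih => simp [subst, cbvEnc, ih hB, subst_succ_lift]
  | add M N ihM ihN => simp [subst, cbvEnc, ihM hB, ihN hB, subst_succ_lift]

theorem colon_of_isBase {B : Term R} (hB : IsBase B) (K : Term R) :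
    colon B K = app K (psi B) := by
  cases hB <;> simp [colon, psi]

theorem colon_app_of_isBase {B : Term R} (hB : IsBase B) (N K : Term R) :
    colon (app B N) K =
      colon N (lam (app (app (lift 0 (psi B)) (var 0)) (lift 0 K))) := by
  cases hB <;> simp [colon, psi, lift]

section Reduction

variable [CommRing R]

local infix:50 " ↠ " => Relation.ReflTransGen StepAB

theorem StepAB.beta (M N : Term R) : StepAB (app (lam M) N) (subst 0 N M) :=
  .inr (.beta M N)

theorem StepAB.appL {M M' : Term R} (h : StepAB M M') (N : Term R) :
    StepAB (app M N) (app M' N) :=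
  h.imp (.ctxAppL N) (.ctxAppL N)

theorem reduces_appL {M M' : Term R} (h : M ↠ M') (N : Term R) : app M N ↠ app M' N :=
  h.lift (app · N) fun _ _ h => h.appL N

theorem reduces_smul {M M' : Term R} (a : R) (h : M ↠ M') : smul a M ↠ smul a M' :=
  h.lift (smul a) fun _ _ h => h.imp (.ctxSmul a) (.ctxSmul a)

theorem reduces_add {M M' N N' : Term R} (hM : M ↠ M') (hN : N ↠ N') :
    add M N ↠ add M' N' :=
  (hM.lift (add · N) fun _ _ h => h.imp (.ctxAddL N) (.ctxAddL N)).trans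
    (hN.lift (add M') fun _ _ h => h.imp (.ctxAddR M') (.ctxAddR M'))

/-- The continuation waiting for the value of the function part of an application
with argument `N` and continuation `K`. -/
def appCont (N K : Term R) : Term R :=
  lam (app (lift 0 (cbvEnc N))
    (lam (app (app (var 1) (var 0)) (lift 0 (lift 0 K)))))

theorem colon_appCont (L N K : Term R) (hN : ∀ K, app (cbvEnc N) K ↠ colon N K) :
    colon L (appCont N K) ↠ colon (app L N) K := by
  have hbase : ∀ {B : Term R}, IsBase B →
      colon B (appCont N K) ↠ colon (app B N) K := by
    intro B hB
    rw [colon_of_isBase hB, colon_app_of_isBase hB]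
    refine .head (StepAB.beta _ _) ?_
    simpa [subst, subst_lift_self, subst_succ_lift] using hN _
  induction L with
  | var n => exact hbase (.var n)
  | lam M => exact hbase (.lam M)
  | app M M' => simpa only [colon] using .refl
  | zero => simpa only [colon] using .refl
  | smul a M ih => simpa only [colon] using reduces_smul a ih
  | add M M' ihM ihM' => simpa only [colon] using reduces_add ihM ihM'

theorem app_cbvEnc_of_isBase_reduces {B : Term R} (hB : IsBase B) (K : Term R) :
    app (cbvEnc B) K ↠ colon B K := by
  rw [colon_of_isBase hB, cbvEnc_of_isBase hB]
  simpa [subst, subst_lift_self] using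
    Relation.ReflTransGen.single (StepAB.beta (app (var 0) (lift 0 (psi B))) K)

theorem app_cbvEnc_reduces (M K : Term R) : app (cbvEnc M) K ↠ colon M K := by
  induction M generalizing K with
  | var n => exact app_cbvEnc_of_isBase_reduces (.var n) K
  | lam M => exact app_cbvEnc_of_isBase_reduces (.lam M) K
  | app M N ihM ihN =>
    refine .head (StepAB.beta _ _) (.trans ?_ (colon_appCont M N K ihN))
    simpa [subst, subst_lift_self, subst_succ_lift, appCont] using ihM (appCont N K)
  | zero => simpa only [colon] using .single (.inl (.appZero K))
  | smul a M ih =>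
    refine .head (StepAB.beta _ _) ?_
    simp only [subst, subst_lift_self, colon, lt_irrefl, if_true, if_false]
    exact .head (.inl (.appSmul _ _ _)) (reduces_smul a (ih K))
  | add M N ihM ihN =>
    refine .head (StepAB.beta _ _) ?_
    simp only [subst, subst_lift_self, colon, lt_irrefl, if_true, if_false]
    exact .head (.inl (.appAdd _ _ _)) (reduces_add (ihM K) (ihN K))

theorem colon_app_right_reduces {V M M' : Term R} (hV : IsValue V)
    (h : ∀ K, colon M K ↠ colon M' K) (K : Term R) :
    colon (app V M) K ↠ colon (app V M') K := by
  induction hV with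
  | zero => simpa only [colon] using .refl
  | base hB => simpa only [colon_app_of_isBase hB] using h _
  | smul a _ ih => simpa only [colon] using reduces_smul a ih
  | add _ _ ihV ihW => simpa only [colon] using reduces_add ihV ihW

/-- A simulation step that is also stable under placing both terms in function position. -/
def Simulates (M M' : Term R) : Prop :=
  (∀ K, colon M K ↠ colon M' K) ∧ ∀ N K, colon (app M N) K ↠ colon (app M' N) K

theorem Simulates.of_app {M₁ M₂ M' : Term R}
    (h : ∀ K, colon (app M₁ M₂) K ↠ colon M' K) : Simulates (app M₁ M₂) M' :=
  ⟨h, fun N K => .trans (by simpa only [colon, appCont] using h (appCont N K))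
    (colon_appCont M' N K (app_cbvEnc_reduces N))⟩

theorem Simulates.addL {M M' : Term R} (h : Simulates M M') (N : Term R) :
    Simulates (add M N) (add M' N) := by
  constructor <;> intros <;> simp only [colon]
  exacts [reduces_add (h.1 _) .refl, reduces_add (h.2 _ _) .refl]

theorem Simulates.addR {N N' : Term R} (h : Simulates N N') (M : Term R) :
    Simulates (add M N) (add M N') := by
  constructor <;> intros <;> simp only [colon]
  exacts [reduces_add .refl (h.1 _), reduces_add .refl (h.2 _ _)]

theorem Simulates.smul {M M' : Term R} (h : Simulates M M') (a : R) :
    Simulates (smul a M) (smul a M') := by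
  constructor <;> intros <;> simp only [colon]
  exacts [reduces_smul a (h.1 _), reduces_smul a (h.2 _ _)]

theorem Simulates.appL {M M' : Term R} (h : Simulates M M') (N : Term R) :
    Simulates (app M N) (app M' N) :=
  .of_app (h.2 N)

theorem Simulates.appR {V M M' : Term R} (hV : IsValue V) (h : Simulates M M') :
    Simulates (app V M) (app V M') :=
  .of_app (colon_app_right_reduces hV h.1)

theorem StepL.simulates {M M' : Term R} (h : StepL M M') : Simulates M M' := by
  induction h with
  | ctxAppL N _ ih => exact ih.appL N
  | ctxAddL N _ ih => exact ih.addL N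
  | ctxAddR M _ ih => exact ih.addR M
  | ctxSmul a _ ih => exact ih.smul a
  | ctxAppR hV _ ih => exact ih.appR hV
  | appAddV | appSmulV | appZeroV =>
    exact .of_app fun K => by simpa only [colon] using .refl
  | appAddB _ _ hB | appSmulB _ _ hB | appZeroB hB =>
    exact .of_app fun K => by simpa only [colon_app_of_isBase hB, colon] using .refl
  | _ => constructor <;> intros <;> simp only [colon] <;> exact .single (.inl (by constructor))

theorem colon_beta_reduces (M K : Term R) {B : Term R} (hB : IsBase B) :
    colon (app (lam M) B) K ↠ colon (subst 0 B M) K := by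
  rw [colon_app_of_isBase (.lam M), colon_of_isBase hB]
  refine .head (StepAB.beta _ _) ?_
  simp only [subst, subst_lift_self, lt_irrefl, if_true, if_false, psi]
  refine .head ((StepAB.beta _ _).appL _) ?_
  rw [← cbvEnc_subst M hB]
  exact app_cbvEnc_reduces _ K

theorem StepBv.simulates {M M' : Term R} (h : StepBv M M') : Simulates M M' := by
  induction h with
  | beta M hB => exact .of_app fun K => colon_beta_reduces M K hB
  | ctxAppL N _ ih => exact ih.appL N
  | ctxAddL N _ ih => exact ih.addL N
  | ctxAddR M _ ih => exact ih.addR M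
  | ctxSmul a _ ih => exact ih.smul a
  | ctxAppR hV _ ih => exact ih.appR hV

end Reduction

section Statements

variable [CommRing R]

/-- if `M →ℓ∪β N`, then for every base term `K`, `M:K →a∪β* N:K`. -/
theorem colon_step (M N : Term R) (h : StepLB M N) (K : Term R) (hK : IsBase K) :
    Relation.ReflTransGen StepAB (colon M K) (colon N K) := by
  exact h.elim (fun h => h.simulates.1 K) (fun h => h.simulates.1 K)

end Statements

end Term

end AlgLam
end
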